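/- arXiv:math/0509671 — 2 statements merged into one kernel-verified Lean document; each statement's English description precedes it below -/
import Mathlib

section
/- Fix an integer d ≥ 1 and let N : ℤ × ℤ × ℤ → ℚ satisfy hypotheses (H0), (H1), and in addition (H2): N(a, b−1, 1) = 4·N(a−1, b, 0) whenever a ≥ 1, b ≥ 1 and a + 2b = 3d. Then there exists a function K : ℕ → ℚ such that for all integers b ≥ 0 and c ≥ 0 and every integer t with 0 ≤ t ≤ 3d − 1 − 2b − c, one has N(3d − 1 − 2b − c − t, b, c) = 2^c · K(b+c) · (C(t,c) + 2·C(t,c−1)). -/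
/-- The binomial coefficient `C(t, j)` for integers `t` and `j`, equal to
`t choose j` when `t ≥ 0` and `0 ≤ j ≤ t`, and `0` when `j < 0` or `j > t`. -/
def binomC (t j : ℤ) : ℚ :=
  if 0 ≤ j then (t.toNat.choose j.toNat : ℚ) else 0

theorem binomC_of_neg {t j : ℤ} (hj : j < 0) : binomC t j = 0 := by
  simp [binomC, not_le.mpr hj]

theorem binomC_zero_right (t : ℤ) : binomC t 0 = 1 := by
  simp [binomC]

theorem binomC_zero_left_of_pos {j : ℤ} (hj : 0 < j) : binomC 0 j = 0 := by
  obtain ⟨k, rfl⟩ : ∃ k : ℕ, j = k + 1 := ⟨(j - 1).toNat, by omega⟩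
  have hk : ((k : ℤ) + 1).toNat = k + 1 := by omega
  simp [binomC, hk]

/-- Pascal's rule for `binomC`. -/
theorem binomC_add_one (t : ℕ) (j : ℤ) :
    binomC ((t : ℤ) + 1) j = binomC t j + binomC t (j - 1) := by
  have ht : ((t : ℤ) + 1).toNat = t + 1 := by omega
  rcases lt_trichotomy j 0 with hj | rfl | hj
  · rw [binomC_of_neg hj, binomC_of_neg hj, binomC_of_neg (by omega), add_zero]
  · rw [binomC_zero_right, binomC_zero_right, binomC_of_neg (by omega), add_zero]
  · obtain ⟨k, rfl⟩ : ∃ k : ℕ, j = k + 1 := ⟨(j - 1).toNat, by omega⟩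
    have hk : ((k : ℤ) + 1).toNat = k + 1 := by omega
    have hk0 : (0 : ℤ) ≤ k + 1 := by omega
    simp [binomC, ht, hk, hk0, Nat.choose_succ_succ, add_comm]

/-- **Equation (4.4) (eq:main_1) of the paper.**  If `N : ℤ × ℤ × ℤ → ℚ`
satisfies (H0), (H1) and (H2), then there are numbers `K λ` such that
`N (3d-1-2b-c-t) b c = 2^c · K (b+c) · (C(t,c) + 2·C(t,c-1))`. -/
theorem main_recursion_structure
    (d : ℤ) (hd : 1 ≤ d) (N : ℤ → ℤ → ℤ → ℚ)
    (H0 : ∀ a b c : ℤ,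
      ¬(0 ≤ a ∧ 0 ≤ b ∧ 0 ≤ c ∧ a + 2 * b + 2 * c ≤ 3 * d ∧
        a + 2 * b + c ≤ 3 * d - 1) → N a b c = 0)
    (H1 : ∀ a b c : ℤ, 0 ≤ a → 0 ≤ b → 0 ≤ c → a + 2 * b + c < 3 * d - 1 →
      N a b c = N (a + 1) b c + 2 * N a (b + 1) (c - 1))
    (H2 : ∀ a b : ℤ, 1 ≤ a → 1 ≤ b → a + 2 * b = 3 * d →
      N a (b - 1) 1 = 4 * N (a - 1) b 0) :
    ∃ K : ℕ → ℚ, ∀ b c : ℤ, 0 ≤ b → 0 ≤ c →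
      ∀ t : ℤ, 0 ≤ t → t ≤ 3 * d - 1 - 2 * b - c →
        N (3 * d - 1 - 2 * b - c - t) b c =
          2 ^ c.toNat * K (b + c).toNat * (binomC t c + 2 * binomC t (c - 1)) := by
  refine ⟨fun l => if 2 * (l : ℤ) = 3 * d then N 0 (l - 1) 1 / 4
    else N (3 * d - 1 - 2 * l) l 0, ?_⟩
  intro b c hb hc t ht
  lift t to ℕ using ht
  induction t generalizing b c with
  | zero =>
    intro hle
    simp only [Nat.cast_zero, sub_zero] at hle ⊢
    obtain rfl | rfl | hc2 : c = 0 ∨ c = 1 ∨ 2 ≤ c := by omega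
    · have hb' : ((b + 0).toNat : ℤ) = b := by omega
      simp only [hb']
      rw [if_neg (by omega), binomC_zero_right, binomC_of_neg (by omega)]
      simp
    · have hb' : ((b + 1).toNat : ℤ) = b + 1 := by omega
      simp only [hb']
      rw [binomC_zero_left_of_pos one_pos, sub_self, binomC_zero_right]
      split_ifs with h
      · have h0 : 3 * d - 1 - 2 * b - 1 = 0 := by omega
        rw [h0, add_sub_cancel_right]
        norm_num
        ring
      · have key := H2 (3 * d - 1 - 2 * b - 1) (b + 1) (by omega) (by omega) (by omega)
        have h1 : 3 * d - 1 - 2 * b - 1 - 1 = 3 * d - 1 - 2 * (b + 1) := by ring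
        rw [add_sub_cancel_right, h1] at key
        rw [key]
        norm_num
        ring
    · rw [H0 _ _ _ (by omega), binomC_zero_left_of_pos (by omega),
        binomC_zero_left_of_pos (by omega)]
      simp
  | succ t ih =>
    intro hle
    push_cast at hle ⊢
    have e1 : 3 * d - 1 - 2 * b - c - ((t : ℤ) + 1) + 1 = 3 * d - 1 - 2 * b - c - t := by ring
    have e2 : 3 * d - 1 - 2 * b - c - ((t : ℤ) + 1)
        = 3 * d - 1 - 2 * (b + 1) - (c - 1) - t := by ring
    rw [H1 _ _ _ (by omega) hb hc (by omega), e1, ih b c hb hc (by omega),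
      binomC_add_one, binomC_add_one]
    obtain rfl | hc1 : c = 0 ∨ 1 ≤ c := by omega
    · rw [H0 _ _ (0 - 1) (by omega), binomC_of_neg (j := 0 - 1) (by omega),
        binomC_of_neg (j := 0 - 1 - 1) (by omega)]
      ring
    · have e3 : b + 1 + (c - 1) = b + c := by ring
      have e4 : c.toNat = (c - 1).toNat + 1 := by omega
      rw [e2, ih (b + 1) (c - 1) (by omega) (by omega) (by omega), e3, e4, pow_succ]
      ring
end

section
/- Fix an integer d ≥ 1 and let N : ℤ × ℤ × ℤ → ℚ satisfy hypotheses (H0) and (H1). Then for all integers b ≥ 0 and c ≥ 1 with 2b + 2c = 3d, one has N(0, b, c) = 2^(c−1) · N(0, b + c − 1, 1). -/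
/-- **Boundary case `2b + 2c = 3d` in Section 4 of the paper.**  If
`N : ℤ × ℤ × ℤ → ℚ` satisfies (H0) and (H1), then for `b ≥ 0`, `c ≥ 1` with
`2b + 2c = 3d` one has `N(0,b,c) = 2^(c-1) · N(0, b+c-1, 1)`. -/
theorem boundary_case_identity
    (d : ℤ) (hd : 1 ≤ d) (N : ℤ → ℤ → ℤ → ℚ)
    (H0 : ∀ a b c : ℤ,
      ¬(0 ≤ a ∧ 0 ≤ b ∧ 0 ≤ c ∧ a + 2 * b + 2 * c ≤ 3 * d ∧
        a + 2 * b + c ≤ 3 * d - 1) → N a b c = 0)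
    (H1 : ∀ a b c : ℤ, 0 ≤ a → 0 ≤ b → 0 ≤ c → a + 2 * b + c < 3 * d - 1 →
      N a b c = N (a + 1) b c + 2 * N a (b + 1) (c - 1)) :
    ∀ b c : ℤ, 0 ≤ b → 1 ≤ c → 2 * b + 2 * c = 3 * d →
      N 0 b c = 2 ^ (c - 1).toNat * N 0 (b + c - 1) 1 := by
  intro b c hb hc h
  obtain ⟨n, rfl⟩ : ∃ n : ℕ, c = n + 1 := ⟨(c - 1).toNat, by omega⟩
  rw [add_sub_cancel_right, Int.toNat_natCast]
  induction n generalizing b with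
  | zero => simp
  | succ n ih =>
    push_cast at h ⊢
    rw [H1 0 b (n + 1 + 1) le_rfl hb (by omega) (by omega),
      H0 (0 + 1) b (n + 1 + 1) (by omega), add_sub_cancel_right,
      ih (b + 1) (by omega) (by omega) (by omega),
      show b + 1 + ((n : ℤ) + 1) - 1 = b + (n + 1 + 1) - 1 by ring]
    ring
end
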